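/- Let T be a finite type set with |T| = m, let f be an arbitrary full-support probability distribution on T, let O be a finite outcome set, and let v : T × O → ℝ≥0 be a valuation. For every ε ≥ 0 and every mechanism M = (x, p) on this data that is ε-BIC and IR, there exists a mechanism M' = (x', p') on the same data that is BIC and IR, satisfies W(M') ≥ W(M) and R(M') ≥ R(M) − m·ε, and is (ex ante) allocation-invariant: ∑_{t∈T} f(t)·x'(t) = ∑_{t∈T} f(t)·x(t) as distributions over O. -/

import Mathlib

open Finset

lemma aux_small {ι : Type} [Finite ι] (g : ι → ℝ) (hg : ∀ i, 0 < g i) :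
    ∃ δ : ℝ, 0 < δ ∧ ∀ i, δ ≤ g i := by
  classical
  haveI := Fintype.ofFinite ι
  rcases isEmpty_or_nonempty ι with h | h
  · exact ⟨1, one_pos, fun i => (h.false i).elim⟩
  · obtain ⟨i, hi⟩ := Finite.exists_min g
    exact ⟨g i, hg i, hi⟩

lemma aux_compact {T : Type} [Fintype T] (f : T → ℝ) (hf : ∀ t, 0 < f t)
    (w : T → T → ℝ) (V : ℝ) :
    IsCompact {z : (T → ℝ) × (T → ℝ) | (∀ t, 0 ≤ z.1 t) ∧ (∀ t, 0 ≤ z.2 t) ∧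
      (∀ t s, w t s ≤ z.1 t + z.2 s) ∧ ∑ t, f t * z.1 t + ∑ t, f t * z.2 t ≤ V} := by
  refine IsCompact.of_isClosed_subset (isCompact_Icc (a := ((0, 0) : (T → ℝ) × (T → ℝ)))
    (b := (fun t => V / f t, fun t => V / f t))) ?_ ?_
  · simp only [Set.ofPred_and, Set.ofPred_forall]
    refine IsClosed.inter ?_ (IsClosed.inter ?_ (IsClosed.inter ?_ ?_))
    · exact isClosed_iInter fun t => isClosed_le (by fun_prop) (by fun_prop)
    · exact isClosed_iInter fun t => isClosed_le (by fun_prop) (by fun_prop)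
    · exact isClosed_iInter fun t => isClosed_iInter fun s =>
        isClosed_le (by fun_prop) (by fun_prop)
    · exact isClosed_le (by fun_prop) (by fun_prop)
  · rintro ⟨u, q⟩ ⟨h1, h2, -, h4⟩
    simp only at h1 h2 h4
    have a1 : ∀ t, 0 ≤ f t * u t := fun t => mul_nonneg (hf t).le (h1 t)
    have a2 : ∀ t, 0 ≤ f t * q t := fun t => mul_nonneg (hf t).le (h2 t)
    have b1 : 0 ≤ ∑ t, f t * u t := Finset.sum_nonneg fun t _ => a1 t
    have b2 : 0 ≤ ∑ t, f t * q t := Finset.sum_nonneg fun t _ => a2 t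
    refine ⟨⟨fun t => h1 t, fun t => h2 t⟩, ⟨fun t => ?_, fun t => ?_⟩⟩
    · have := Finset.single_le_sum (f := fun t => f t * u t) (fun t _ => a1 t) (mem_univ t)
      simp only at this ⊢
      rw [le_div_iff₀ (hf t)]; linarith
    · have := Finset.single_le_sum (f := fun t => f t * q t) (fun t _ => a2 t) (mem_univ t)
      simp only at this ⊢
      rw [le_div_iff₀ (hf t)]; linarith

lemma aux_dual {T : Type} [Fintype T] [Nonempty T] (f : T → ℝ) (hf : ∀ t, 0 < f t)
    (hf1 : ∑ t, f t = 1) (w : T → T → ℝ) (hw : ∀ t s, 0 ≤ w t s) :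
    ∃ u q : T → ℝ, (∀ t, 0 ≤ u t) ∧ (∀ t, 0 ≤ q t) ∧ (∀ t s, w t s ≤ u t + q s) ∧
      (∀ u' q' : T → ℝ, (∀ t s, w t s ≤ u' t + q' s) →
        ∑ t, f t * u t + ∑ t, f t * q t ≤ ∑ t, f t * u' t + ∑ t, f t * q' t) ∧
      (∀ u' q' : T → ℝ, (∀ t, 0 ≤ u' t) → (∀ t, 0 ≤ q' t) → (∀ t s, w t s ≤ u' t + q' s) →
        ∑ t, f t * u' t + ∑ t, f t * q' t ≤ ∑ t, f t * u t + ∑ t, f t * q t →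
        ∑ t, f t * q' t ≤ ∑ t, f t * q t) := by
  set φ : (T → ℝ) × (T → ℝ) → ℝ := fun z => ∑ t, f t * z.1 t + ∑ t, f t * z.2 t with hφ
  have hφc : Continuous φ := by fun_prop
  let z0 : (T → ℝ) × (T → ℝ) := (fun t => ∑ s, w t s, fun _ => 0)
  have hz0 : ∀ t s, w t s ≤ z0.1 t + z0.2 s := fun t s => by
    have := Finset.single_le_sum (f := fun s => w t s) (fun s _ => hw t s) (mem_univ s)
    simpa [z0] using this
  obtain ⟨z1, hz1, hmin⟩ := (aux_compact f hf w (φ z0)).exists_isMinOn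
    ⟨z0, fun t => Finset.sum_nonneg fun s _ => hw t s, fun t => le_rfl, hz0, le_rfl⟩
    hφc.continuousOn
  obtain ⟨z, hz, hmax⟩ := (aux_compact f hf w (φ z1)).exists_isMaxOn
    ⟨z1, hz1.1, hz1.2.1, hz1.2.2.1, le_rfl⟩
    (f := fun z => ∑ t, f t * z.2 t) (by fun_prop)
  -- minimality among nonneg
  have key : ∀ u' q' : T → ℝ, (∀ t, 0 ≤ u' t) → (∀ t, 0 ≤ q' t) →
      (∀ t s, w t s ≤ u' t + q' s) → φ z1 ≤ φ (u', q') := by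
    intro u' q' h1 h2 h3
    by_cases h : φ (u', q') ≤ φ z0
    · exact hmin ⟨h1, h2, h3, h⟩
    · have : φ z1 ≤ φ z0 := hz1.2.2.2
      linarith
  refine ⟨z.1, z.2, hz.1, hz.2.1, hz.2.2.1, ?_, ?_⟩
  · intro u' q' h
    obtain ⟨t0, ht0⟩ := Finite.exists_min u'
    have := key (fun t => u' t - u' t0) (fun t => q' t + u' t0)
      (fun t => by linarith [ht0 t]) (fun s => by linarith [h t0 s, hw t0 s])
      (fun t s => by linarith [h t s])
    have e : φ (fun t => u' t - u' t0, fun t => q' t + u' t0)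
        = ∑ t, f t * u' t + ∑ t, f t * q' t := by
      simp only [hφ, mul_sub, mul_add, Finset.sum_sub_distrib, Finset.sum_add_distrib,
        ← Finset.sum_mul, hf1]
      ring
    rw [e] at this
    exact hz.2.2.2.trans this
  · intro u' q' h1 h2 h3 h4
    exact hmax (show (u', q') ∈ _ from ⟨h1, h2, h3, h4.trans hz.2.2.2⟩)

lemma aux_pi {T : Type} [Fintype T] (f : T → ℝ)
    (hf1 : ∑ t, f t = 1) (w : T → T → ℝ) (u q : T → ℝ)
    (hfe : ∀ t s, w t s ≤ u t + q s)
    (hopt : ∀ u' q' : T → ℝ, (∀ t s, w t s ≤ u' t + q' s) →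
        ∑ t, f t * u t + ∑ t, f t * q t ≤ ∑ t, f t * u' t + ∑ t, f t * q' t) :
    ∃ π : T → T → ℝ, (∀ t s, 0 ≤ π t s) ∧ (∀ t, ∑ s, π t s = f t) ∧
      (∀ s, ∑ t, π t s = f s) ∧ ∀ t s, π t s * (u t + q s - w t s) = 0 := by
  classical
  let L : (T × T → ℝ) → (T → ℝ) × (T → ℝ) :=
    fun y => (fun t => ∑ s, y (t, s), fun s => ∑ t, y (t, s))
  have hL : IsLinearMap ℝ L := by
    constructor
    · intro x y
      ext <;> simp [L, Finset.sum_add_distrib]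
    · intro c x
      ext <;> simp [L, Finset.mul_sum]
  have hLc : Continuous L := by fun_prop
  let A : Set (T × T → ℝ) := stdSimplex ℝ (T × T) ∩
    {y | ∀ t s, y (t, s) * (u t + q s - w t s) = 0}
  have hAc : IsCompact A := by
    refine (isCompact_stdSimplex ℝ (T × T)).inter_right ?_
    simp only [Set.ofPred_forall]
    exact isClosed_iInter fun t => isClosed_iInter fun s =>
        isClosed_eq (by fun_prop) (by fun_prop)
  have hAv : Convex ℝ A := by
    refine (convex_stdSimplex ℝ (T × T)).inter ?_
    intro x hx y hy a b _ _ _ t s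
    have h1 := hx t s
    have h2 := hy t s
    simp only [Pi.add_apply, Pi.smul_apply, smul_eq_mul]
    linear_combination a * h1 + b * h2
  by_cases hmem : (f, f) ∈ L '' A
  · obtain ⟨y, hy, e⟩ := hmem
    refine ⟨fun t s => y (t, s), fun t s => hy.1.1 _, fun t => ?_, fun s => ?_, hy.2⟩
    · exact congrFun (congrArg Prod.fst e) t
    · exact congrFun (congrArg Prod.snd e) s
  exfalso
  obtain ⟨l, c, h1, h2⟩ := geometric_hahn_banach_point_closed (hAv.is_linear_image hL)
    (hAc.image hLc).isClosed hmem
  set a : T → ℝ := fun t => l (Pi.single t 1, 0) with ha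
  set b : T → ℝ := fun t => l (0, Pi.single t 1) with hb
  have hl : ∀ y z : T → ℝ, l (y, z) = ∑ t, y t * a t + ∑ t, z t * b t := by
    intro y z
    have : (y, z) = ∑ t, y t • ((Pi.single t 1, 0) : (T → ℝ) × (T → ℝ))
        + ∑ t, z t • ((0, Pi.single t 1) : (T → ℝ) × (T → ℝ)) := by
      ext i <;> simp [Prod.fst_sum, Prod.snd_sum, Finset.sum_apply, Pi.single_apply]
    rw [this, map_add, map_sum, map_sum]
    simp only [map_smul, smul_eq_mul, ha, hb]
  have htight : ∀ t s, u t + q s = w t s → c < a t + b s := by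
    intro t s hts
    have := h2 (L (Pi.single (t, s) 1)) ⟨_, ⟨single_mem_stdSimplex ℝ (t, s), ?_⟩, rfl⟩
    · have e : L (Pi.single (t, s) 1) = (Pi.single t 1, Pi.single s 1) := by
        ext i <;> simp [L, Pi.single_apply, Prod.ext_iff, ite_and]
      rw [e, hl] at this
      simpa [Pi.single_apply] using this
    · intro t' s'
      by_cases h : (t', s') = (t, s)
      · obtain ⟨rfl, rfl⟩ := Prod.ext_iff.1 h
        simp at hts ⊢; linarith
      · simp [Pi.single_apply, h]
  rw [hl] at h1
  -- small step
  obtain ⟨δ, hδ, hs⟩ := aux_small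
    (fun i : T × T => if u i.1 + q i.2 = w i.1 i.2 then 1 else
      (u i.1 + q i.2 - w i.1 i.2) / (1 + |a i.1 + b i.2 - c|)) (by
      rintro ⟨t, s⟩
      simp only
      split_ifs with h
      · exact one_pos
      · have := lt_of_le_of_ne (hfe t s) (Ne.symm h)
        apply div_pos <;> [linarith; positivity])
  have := hopt (fun t => u t + δ * (a t - c)) (fun s => q s + δ * b s) (by
    intro t s
    by_cases h : u t + q s = w t s
    · have := htight t s h
      nlinarith
    · have h3 := hs (t, s)
      simp only [h, if_false] at h3
      rw [le_div_iff₀ (by positivity)] at h3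
      have := neg_abs_le (a t + b s - c)
      nlinarith)
  have e1 : ∑ t, f t * (u t + δ * (a t - c)) = ∑ t, f t * u t + δ * (∑ t, f t * a t - c) := by
    simp only [mul_add, mul_sub, Finset.sum_add_distrib, Finset.sum_sub_distrib,
      mul_left_comm _ δ, ← Finset.mul_sum, ← Finset.sum_mul, hf1, one_mul]
  have e2 : ∑ t, f t * (q t + δ * b t) = ∑ t, f t * q t + δ * (∑ t, f t * b t) := by
    rw [Finset.mul_sum, ← Finset.sum_add_distrib]
    exact Finset.sum_congr rfl fun t _ => by ring
  rw [e1, e2] at this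
  nlinarith

lemma aux_loss {T : Type} [Fintype T] (m : ℕ) (hm : Fintype.card T = m)
    (f : T → ℝ) (hf : ∀ t, 0 < f t) (w : T → T → ℝ) (u q : T → ℝ)
    (ε : ℝ) (hε : 0 ≤ ε) (p : T → ℝ)
    (hB : ∀ t s, w t t - p t ≥ w t s - p s - ε) (hI : ∀ t, 0 ≤ w t t - p t)
    (hu : ∀ t, 0 ≤ u t) (hq : ∀ t, 0 ≤ q t) (hfe : ∀ t s, w t s ≤ u t + q s)
    (hmax : ∀ u' q' : T → ℝ, (∀ t, 0 ≤ u' t) → (∀ t, 0 ≤ q' t) → (∀ t s, w t s ≤ u' t + q' s) →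
        ∑ t, f t * u' t + ∑ t, f t * q' t ≤ ∑ t, f t * u t + ∑ t, f t * q t →
        ∑ t, f t * q' t ≤ ∑ t, f t * q t) :
    ∀ s, p s - m * ε ≤ q s := by
  classical
  intro s0
  by_contra! hs0
  have hgap : ∃ k : Fin m, ∀ s, ¬ ((k : ℝ) * ε < p s - q s ∧ p s - q s ≤ ((k : ℝ) + 1) * ε) := by
    by_contra! h
    choose g hg1 hg2 using h
    have mono : ∀ i j : Fin m, i < j → g i ≠ g j := by
      intro i j hij e
      have h1 := hg2 i
      have h2 := hg1 j
      rw [← e] at h2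
      have : ((i : ℕ) : ℝ) + 1 ≤ ((j : ℕ) : ℝ) := by exact_mod_cast hij
      nlinarith
    have hinj : Function.Injective g := by
      intro i j e
      rcases lt_trichotomy i j with h | h | h
      · exact (mono i j h e).elim
      · exact h
      · exact (mono j i h e.symm).elim
    have hsurj := ((Fintype.bijective_iff_injective_and_card g).2 ⟨hinj, by simp [hm]⟩).2
    obtain ⟨k, hk⟩ := hsurj s0
    have h1 := hg2 k
    rw [hk] at h1
    have : ((k : ℕ) : ℝ) + 1 ≤ (m : ℝ) := by exact_mod_cast k.2
    nlinarith
  obtain ⟨k, hk⟩ := hgap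
  have hk0 : (0 : ℝ) ≤ (k : ℕ) := Nat.cast_nonneg _
  have hkm : ((k : ℕ) : ℝ) + 1 ≤ (m : ℝ) := by exact_mod_cast k.2
  set θ : ℝ := ((k : ℝ) + 1) * ε with hθ
  have hθ0 : 0 ≤ θ := by positivity
  have hlow : ∀ s, ¬ θ < p s - q s → p s - q s ≤ θ - ε := by
    intro s hs
    by_contra! h
    exact hk s ⟨by rw [hθ] at h; linarith, not_lt.1 hs⟩
  obtain ⟨δ, hδ, hsm⟩ := aux_small
    (fun i : T × T => if θ < p i.1 - q i.1 ∧ ¬ θ < p i.2 - q i.2 then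
      min (p i.1 - q i.1 - ε - (p i.2 - q i.2)) (p i.1 - q i.1)
      else if θ < p i.1 - q i.1 then p i.1 - q i.1 else 1) (by
      rintro ⟨t, s⟩
      simp only
      split_ifs with h h'
      · have := hlow s h.2
        exact lt_min (by linarith [h.1]) (by linarith [h.1])
      · linarith
      · exact one_pos)
  let χ : T → ℝ := fun t => if θ < p t - q t then δ else 0
  have hχ : ∀ t, 0 ≤ χ t := fun t => by simp only [χ]; split_ifs <;> linarith
  have := hmax (fun t => u t - χ t) (fun t => q t + χ t) (by
      intro t
      simp only [χ]
      split_ifs with h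
      · have h1 := hsm (t, t)
        simp only [h, not_true, and_false, if_false, if_true] at h1
        linarith [hfe t t, hI t]
      · linarith [hu t])
    (fun t => by linarith [hq t, hχ t]) (by
      intro t s
      by_cases h : θ < p t - q t
      · by_cases h' : θ < p s - q s
        · simp only [χ, h, h', if_true]; linarith [hfe t s]
        · have h1 := hsm (t, s)
          simp only [h, h', not_false_eq_true, and_self, if_true] at h1
          have h2 := h1.trans (min_le_left _ _)
          simp only [χ, h, h', if_true, if_false]
          linarith [hB t s, hfe t t]
      · have := hχ s
        simp only [χ, h, if_false] at this ⊢
        linarith [hfe t s]) (by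
      rw [← Finset.sum_add_distrib, ← Finset.sum_add_distrib]
      exact Finset.sum_le_sum fun t _ => by nlinarith)
  simp only [mul_add, Finset.sum_add_distrib] at this
  have hpos : 0 < ∑ t, f t * χ t := by
    refine Finset.sum_pos' (fun t _ => mul_nonneg (hf t).le (hχ t)) ⟨s0, mem_univ _, ?_⟩
    have : θ < p s0 - q s0 := by
      have : θ ≤ m * ε := mul_le_mul_of_nonneg_right hkm hε
      linarith
    simp only [χ, this, if_true]
    exact mul_pos (hf s0) hδ
  linarith



/-- For a single agent with an arbitrary full-support type distribution
over `m` types, every `ε`-BIC and IR mechanism can be transformed into a BIC and IR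
mechanism that preserves welfare, loses at most `m·ε` revenue, and is (ex ante)
allocation-invariant. -/
theorem epsBIC_to_BIC_general_allocation_invariant
    {T O : Type} [Fintype T] [Fintype O] [Nonempty T]
    (m : ℕ) (hm : Fintype.card T = m)
    (f : T → ℝ) (hf : ∀ t, 0 < f t) (hf1 : ∑ t, f t = 1)
    (v : T → O → ℝ) (hv : ∀ t o, 0 ≤ v t o)
    (ε : ℝ) (hε : 0 ≤ ε)
    (x : T → O → ℝ) (p : T → ℝ)
    (hx0 : ∀ t o, 0 ≤ x t o) (hx1 : ∀ t, ∑ o, x t o = 1)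
    (hp : ∀ t, 0 ≤ p t)
    -- M is ε-BIC
    (hBIC : ∀ t t' : T,
      (∑ o, x t o * v t o) - p t ≥ (∑ o, x t' o * v t o) - p t' - ε)
    -- M is IR
    (hIR : ∀ t : T, 0 ≤ (∑ o, x t o * v t o) - p t) :
    ∃ (x' : T → O → ℝ) (p' : T → ℝ),
      (∀ t o, 0 ≤ x' t o) ∧ (∀ t, ∑ o, x' t o = 1) ∧ (∀ t, 0 ≤ p' t) ∧
      -- M' is BIC
      (∀ t t' : T,
        (∑ o, x' t o * v t o) - p' t ≥ (∑ o, x' t' o * v t o) - p' t') ∧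
      -- M' is IR
      (∀ t : T, 0 ≤ (∑ o, x' t o * v t o) - p' t) ∧
      -- W(M') ≥ W(M)
      (∑ t, f t * ∑ o, x' t o * v t o) ≥ (∑ t, f t * ∑ o, x t o * v t o) ∧
      -- R(M') ≥ R(M) − m·ε
      (∑ t, f t * p' t) ≥ (∑ t, f t * p t) - m * ε ∧
      -- (ex ante) allocation-invariance
      (∀ o, ∑ t, f t * x' t o = ∑ t, f t * x t o) := by
  set w : T → T → ℝ := fun t s => ∑ o, x s o * v t o with hw
  have hw0 : ∀ t s, 0 ≤ w t s := fun t s =>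
    Finset.sum_nonneg fun o _ => mul_nonneg (hx0 s o) (hv t o)
  obtain ⟨u, q, hu, hq, hfe, hopt, hmax⟩ := aux_dual f hf hf1 w hw0
  obtain ⟨π, hπ0, hπr, hπc, hπt⟩ := aux_pi f hf1 w u q hfe hopt
  have hloss := aux_loss m hm f hf w u q ε hε p hBIC hIR hu hq hfe hmax
  have hne : ∀ t, f t ≠ 0 := fun t => (hf t).ne'
  have hσ0 : ∀ t s, 0 ≤ π t s / f t := fun t s => div_nonneg (hπ0 t s) (hf t).le
  have hσ1 : ∀ t, ∑ s, π t s / f t = 1 := fun t => by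
    rw [← Finset.sum_div, hπr, div_self (hne t)]
  have hval : ∀ t t', (∑ o, (∑ s, π t' s / f t' * x s o) * v t o)
      = ∑ s, π t' s / f t' * w t s := by
    intro t t'
    simp only [hw, Finset.sum_mul, Finset.mul_sum]
    rw [Finset.sum_comm]
    simp only [mul_assoc]
  have huself : ∀ t, (∑ s, π t s / f t * w t s) - ∑ s, π t s / f t * q s = u t := by
    intro t
    rw [← Finset.sum_sub_distrib]
    calc _ = ∑ s, π t s / f t * u t := Finset.sum_congr rfl fun s _ => by
            linear_combination (-1 / f t) * hπt t s
      _ = u t := by rw [← Finset.sum_mul, hσ1, one_mul]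
  have hcancel : ∀ g : T → T → ℝ, ∑ t, f t * ∑ s, π t s / f t * g t s
      = ∑ t, ∑ s, π t s * g t s := by
    intro g
    refine Finset.sum_congr rfl fun t _ => ?_
    rw [Finset.mul_sum]
    refine Finset.sum_congr rfl fun s _ => ?_
    have := hne t
    field_simp
  have hcol : ∀ g : T → ℝ, ∑ t, f t * ∑ s, π t s / f t * g s = ∑ s, f s * g s := by
    intro g
    rw [hcancel (fun _ s => g s), Finset.sum_comm]
    simp only [← Finset.sum_mul, hπc]
  refine ⟨fun t o => ∑ s, π t s / f t * x s o, fun t => ∑ s, π t s / f t * q s,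
    ?_, ?_, ?_, ?_, ?_, ?_, ?_, ?_⟩
  · exact fun t o => Finset.sum_nonneg fun s _ => mul_nonneg (hσ0 t s) (hx0 s o)
  · intro t
    rw [Finset.sum_comm]
    simp only [← Finset.mul_sum, hx1, mul_one, hσ1]
  · exact fun t => Finset.sum_nonneg fun s _ => mul_nonneg (hσ0 t s) (hq s)
  · intro t t'
    simp only [hval]
    rw [huself, ← Finset.sum_sub_distrib]
    calc _ ≤ ∑ s, π t' s / f t' * u t := Finset.sum_le_sum fun s _ => by
            rw [← mul_sub]
            exact mul_le_mul_of_nonneg_left (by linarith [hfe t s]) (hσ0 t' s)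
      _ = u t := by rw [← Finset.sum_mul, hσ1, one_mul]
  · intro t
    simp only [hval]
    rw [huself]
    exact hu t
  · simp only [hval]
    have e : ∀ t, ∑ s, π t s / f t * w t s = u t + ∑ s, π t s / f t * q s := fun t => by
      linarith [huself t]
    simp only [e, mul_add, Finset.sum_add_distrib, hcol]
    rw [← Finset.sum_add_distrib]
    refine Finset.sum_le_sum fun t _ => ?_
    rw [← mul_add]
    exact mul_le_mul_of_nonneg_left (hfe t t) (hf t).le
  · simp only [hcol]
    have : ∑ t, f t * (p t - m * ε) ≤ ∑ t, f t * q t :=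
      Finset.sum_le_sum fun t _ => mul_le_mul_of_nonneg_left (hloss t) (hf t).le
    simp only [mul_sub, Finset.sum_sub_distrib, ← Finset.sum_mul, hf1, one_mul] at this
    exact this
  · intro o
    exact hcol (fun s => x s o)
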